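/- For every integer k ≥ 2, q(L_2) > q(L_1), where L_1 is the graph on 2k+3 vertices consisting of a vertex w adjacent to all of: 2(k−1) vertices forming k−1 disjoint edges, one further vertex u_1 (of degree 1), and two vertices u_2, u_3, together with one additional vertex w′ (not adjacent to w) adjacent to both u_2 and u_3; and L_2 is the graph obtained from K_1 ∨ (kP_2) (with join vertex w) by attaching a pendant path w–u–v of length 2 at w. -/

import Mathlib

namespace QPaper

open SimpleGraph

/-- The signless Laplacian matrix `Q(G) = D(G) + A(G)` of a graph, over `ℝ`. -/
noncomputable def signlessLap {V : Type*} [Fintype V] [DecidableEq V] (G : SimpleGraph V) :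
    Matrix V V ℝ :=
  letI := Classical.decRel G.Adj
  G.degMatrix ℝ + G.adjMatrix ℝ

/-- The `Q`-index of a graph: the largest eigenvalue of its signless Laplacian matrix. -/
noncomputable def qIndex {V : Type*} [Fintype V] [DecidableEq V] (G : SimpleGraph V) : ℝ :=
  sSup (spectrum ℝ (signlessLap G))

/-- The number of edges (size) of a graph. -/
noncomputable def numEdges {V : Type*} (G : SimpleGraph V) : ℕ :=
  Nat.card G.edgeSet

/-- The degree of a vertex. -/
noncomputable def deg {V : Type*} (G : SimpleGraph V) (v : V) : ℕ :=
  Nat.card (G.neighborSet v)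

/-- A graph is `2` leaves-free if it has at most one vertex of degree one. -/
def TwoLeavesFree {V : Type*} (G : SimpleGraph V) : Prop :=
  ∀ u v : V, deg G u = 1 → deg G v = 1 → u = v

/-- The maximum degree `Δ(G)`. -/
noncomputable def maxDeg {V : Type*} [Fintype V] (G : SimpleGraph V) : ℕ :=
  letI := Classical.decEq V
  letI := Classical.decRel G.Adj
  G.maxDegree

/-- `k` disjoint copies of `P₂`, i.e. a perfect matching on `2k` vertices. -/
def matching (k : ℕ) : SimpleGraph (Fin k × Fin 2) :=
  SimpleGraph.fromRel (fun a b => a.1 = b.1)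

/-- The star graph `Sₙ` on `n` vertices (`K_{1,n-1}` with center `0`). -/
def starGraph (n : ℕ) : SimpleGraph (Fin n) :=
  SimpleGraph.fromRel (fun a _ => (a : ℕ) = 0)

/-- Disjoint union of two graphs. -/
def dUnion {α β : Type*} (G : SimpleGraph α) (H : SimpleGraph β) : SimpleGraph (α ⊕ β) :=
  SimpleGraph.fromRel (fun a b =>
    (∃ x y, a = Sum.inl x ∧ b = Sum.inl y ∧ G.Adj x y) ∨
    (∃ x y, a = Sum.inr x ∧ b = Sum.inr y ∧ H.Adj x y))

/-- The join `K₁ ∨ H` : a new vertex (`none`) adjacent to every vertex of `H`. -/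
def cone {α : Type*} (H : SimpleGraph α) : SimpleGraph (Option α) :=
  SimpleGraph.fromRel (fun a b =>
    a = none ∨ ∃ x y, a = some x ∧ b = some y ∧ H.Adj x y)

/-- The graph `L₁`: a vertex `w` joined to `k-1` disjoint edges and to three further
vertices `u₁,u₂,u₃`, together with an extra vertex `w'` adjacent to `u₂` and `u₃`. -/
def L1 (k : ℕ) : SimpleGraph ((Option ((Fin (k - 1) × Fin 2) ⊕ Fin 3)) ⊕ Fin 1) :=
  SimpleGraph.fromRel (fun a b =>
    (∃ x y, a = Sum.inl x ∧ b = Sum.inl y ∧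
      (cone (dUnion (matching (k - 1)) (⊥ : SimpleGraph (Fin 3)))).Adj x y) ∨
    (∃ i : Fin 3, (i : ℕ) ≠ 0 ∧ a = Sum.inl (some (Sum.inr i)) ∧ b = Sum.inr 0))

/-- The graph `L₂`: `K₁ ∨ (kP₂)` with a pendant path `w–u–v` attached at the join vertex. -/
def L2 (k : ℕ) : SimpleGraph ((Option (Fin k × Fin 2)) ⊕ Fin 2) :=
  SimpleGraph.fromRel (fun a b =>
    (∃ x y, a = Sum.inl x ∧ b = Sum.inl y ∧ (cone (matching k)).Adj x y) ∨
    (a = Sum.inl none ∧ b = Sum.inr 0) ∨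
    (a = Sum.inr 0 ∧ b = Sum.inr 1))

theorem signlessLap_mulVec {V : Type*} [Fintype V] [DecidableEq V] (G : SimpleGraph V)
    [DecidableRel G.Adj] (x : V → ℝ) (i : V) :
    (signlessLap G).mulVec x i = ∑ j, if G.Adj i j then x i + x j else 0 := by
  have h : signlessLap G = G.degMatrix ℝ + G.adjMatrix ℝ := by
    unfold signlessLap
    congr!
  rw [h, Matrix.add_mulVec, Pi.add_apply, SimpleGraph.adjMatrix_mulVec_apply,
    SimpleGraph.degMatrix, Matrix.mulVec_diagonal, ← Finset.sum_filter, Finset.sum_add_distrib,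
    Finset.sum_const, ← SimpleGraph.neighborFinset_eq_filter, SimpleGraph.card_neighborFinset_eq_degree,
    nsmul_eq_mul]

theorem signlessLap_nonneg {V : Type*} [Fintype V] [DecidableEq V] (G : SimpleGraph V) (i j : V) :
    0 ≤ signlessLap G i j := by
  classical
  unfold signlessLap
  simp only [Matrix.add_apply, SimpleGraph.degMatrix, Matrix.diagonal_apply,
    SimpleGraph.adjMatrix_apply]
  positivity

theorem mem_spectrum_iff_exists_mulVec {V : Type*} [Fintype V] [DecidableEq V]
    (M : Matrix V V ℝ) (r : ℝ) :
    r ∈ spectrum ℝ M ↔ ∃ x : V → ℝ, x ≠ 0 ∧ M.mulVec x = r • x := by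
  rw [← Matrix.spectrum_toLin', ← Module.End.hasEigenvalue_iff_mem_spectrum]
  constructor
  · intro h
    obtain ⟨x, hx⟩ := h.exists_hasEigenvector
    exact ⟨x, hx.2, by simpa using hx.apply_eq_smul⟩
  · rintro ⟨x, hx, h⟩
    exact Module.End.hasEigenvalue_of_hasEigenvector
      (Module.End.hasEigenvector_iff.2 ⟨Module.End.mem_eigenspace_iff.2 (by simpa using h), hx⟩)

/-- A nonnegative matrix with a positive `r`-superharmonic vector has no eigenvalue above `r`. -/
theorem le_of_mem_spectrum_of_mulVec_le {V : Type*} [Fintype V] [DecidableEq V]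
    {M : Matrix V V ℝ} (hM : ∀ i j, 0 ≤ M i j) {x : V → ℝ} (hx : ∀ i, 0 < x i) {r l : ℝ}
    (hr : ∀ i, M.mulVec x i ≤ r * x i) (hl : l ∈ spectrum ℝ M) : l ≤ r := by
  obtain ⟨v, hv, h⟩ := (mem_spectrum_iff_exists_mulVec M l).1 hl
  obtain ⟨i₀, hi₀⟩ := Function.ne_iff.1 hv
  obtain ⟨i, -, hi⟩ := Finset.exists_max_image Finset.univ (fun i => |v i| / x i)
    ⟨i₀, Finset.mem_univ _⟩
  set t := |v i| / x i with ht
  have htpos : 0 < t := lt_of_lt_of_le (div_pos (abs_pos.2 hi₀) (hx i₀)) (hi i₀ (Finset.mem_univ _))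
  have hle : ∀ j, |v j| ≤ t * x j := fun j => (div_le_iff₀ (hx j)).1 (hi j (Finset.mem_univ _))
  have heq : |v i| = t * x i := by rw [ht, div_mul_cancel₀ _ (hx i).ne']
  have key : |l| * (t * x i) ≤ r * (t * x i) := by
    calc |l| * (t * x i) = |M.mulVec v i| := by
          rw [h, Pi.smul_apply, smul_eq_mul, abs_mul, heq]
      _ ≤ ∑ j, |M i j * v j| := Finset.abs_sum_le_sum_abs _ _
      _ ≤ ∑ j, t * (M i j * x j) := by
          refine Finset.sum_le_sum fun j _ => ?_
          rw [abs_mul, abs_of_nonneg (hM i j)]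
          calc M i j * |v j| ≤ M i j * (t * x j) := mul_le_mul_of_nonneg_left (hle j) (hM i j)
            _ = _ := by ring
      _ = t * M.mulVec x i := by rw [← Finset.mul_sum]; rfl
      _ ≤ t * (r * x i) := mul_le_mul_of_nonneg_left (hr i) htpos.le
      _ = _ := by ring
  exact (le_abs_self l).trans (le_of_mul_le_mul_right key (mul_pos htpos (hx i)))

theorem le_qIndex {V : Type*} [Fintype V] [DecidableEq V] (G : SimpleGraph V) {r : ℝ}
    {x : V → ℝ} (hx : x ≠ 0) (h : (signlessLap G).mulVec x = r • x) : r ≤ qIndex G :=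
  le_csSup (Matrix.finite_real_spectrum).bddAbove ((mem_spectrum_iff_exists_mulVec _ r).2 ⟨x, hx, h⟩)

theorem qIndex_le {V : Type*} [Fintype V] [DecidableEq V] (G : SimpleGraph V) {r : ℝ}
    (hr : 0 ≤ r) {x : V → ℝ} (hx : ∀ i, 0 < x i)
    (h : ∀ i, (signlessLap G).mulVec x i ≤ r * x i) : qIndex G ≤ r :=
  Real.sSup_le (fun _ hl => le_of_mem_spectrum_of_mulVec_le (signlessLap_nonneg G) hx h hl) hr

/-- At the `Q`-eigenvalues `q` of `L₁` above `4` this equals `q`. -/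
noncomputable def charL1 (k : ℕ) (q : ℝ) : ℝ :=
  2 * k + 1 + 2 * (k - 1) / (q - 3) + 1 / (q - 1) + 2 * (q - 2) / ((q - 2) ^ 2 - 2)

/-- At the `Q`-eigenvalues `q` of `L₂` above `4` this equals `q`. -/
noncomputable def charL2 (k : ℕ) (q : ℝ) : ℝ :=
  2 * k + 1 + 2 * k / (q - 3) + (q - 1) / ((q - 2) * (q - 1) - 1)

theorem charL1_lt_charL2 (k : ℕ) {q : ℝ} (hq : 4 ≤ q) : charL1 k q < charL2 k q := by
  have h3 : 0 < q - 3 := by linarith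
  have h1 : 0 < q - 1 := by linarith
  have hz : 0 < (q - 2) ^ 2 - 2 := by nlinarith
  have hu : 0 < (q - 2) * (q - 1) - 1 := by nlinarith
  have e : charL2 k q - charL1 k q =
      2 * (q - 4) / ((q - 3) * ((q - 2) ^ 2 - 2)) +
        q / (((q - 2) * (q - 1) - 1) * (q - 1)) := by
    have hu' := hu.ne'
    unfold charL1 charL2
    generalize hD : (q - 2) * (q - 1) - 1 = D at *
    field_simp
    rw [← hD]
    ring
  have : 0 ≤ 2 * (q - 4) / ((q - 3) * ((q - 2) ^ 2 - 2)) :=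
    div_nonneg (by linarith) (by positivity)
  have : 0 < q / (((q - 2) * (q - 1) - 1) * (q - 1)) := div_pos (by linarith) (by positivity)
  linarith

theorem charL2_le (k : ℕ) {q : ℝ} (hq : 4 ≤ q) : charL2 k q ≤ 4 * k + 2 := by
  have hu : 0 < (q - 2) * (q - 1) - 1 := by nlinarith
  have a : 2 * (k : ℝ) / (q - 3) ≤ 2 * k := div_le_self (by positivity) (by linarith)
  have b : (q - 1) / ((q - 2) * (q - 1) - 1) ≤ 1 := by
    rw [div_le_one hu]; nlinarith
  unfold charL2
  linarith

theorem exists_charL1_eq {k : ℕ} (hk : 2 ≤ k) : ∃ q : ℝ, 4 < q ∧ q < 4 * k + 2 ∧ charL1 k q = q := by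
  have hk' : (2 : ℝ) ≤ k := by exact_mod_cast hk
  have hc : ContinuousOn (fun q => charL1 k q - q) (Set.Icc 4 (4 * k + 2)) := by
    unfold charL1
    refine ContinuousOn.sub (ContinuousOn.add (ContinuousOn.add (ContinuousOn.add
      continuousOn_const ?_) ?_) ?_) continuousOn_id
    all_goals
      refine ContinuousOn.div (by fun_prop) (by fun_prop) fun q hq => ne_of_gt ?_
      nlinarith [hq.1]
  have hlow : 0 < charL1 k 4 - 4 := by
    unfold charL1
    norm_num
    linarith
  have hup : charL1 k (4 * k + 2) - (4 * k + 2) < 0 := by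
    have h4 : (4 : ℝ) ≤ 4 * k + 2 := by linarith
    linarith [charL1_lt_charL2 k h4, charL2_le k h4]
  obtain ⟨q, hq, h⟩ := intermediate_value_Ioo' (by linarith) hc ⟨hup, hlow⟩
  exact ⟨q, hq.1, hq.2, by simpa [sub_eq_zero] using h⟩

theorem exists_charL2_eq (k : ℕ) {p : ℝ} (hp : 4 ≤ p) (hpk : p < 4 * k + 2)
    (h : p < charL2 k p) : ∃ q, p < q ∧ charL2 k q = q := by
  have hc : ContinuousOn (fun q => charL2 k q - q) (Set.Icc p (4 * k + 2)) := by
    unfold charL2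
    refine ContinuousOn.sub (ContinuousOn.add (ContinuousOn.add
      continuousOn_const ?_) ?_) continuousOn_id
    all_goals
      refine ContinuousOn.div (by fun_prop) (by fun_prop) fun q hq => ne_of_gt ?_
      nlinarith [hq.1]
  have hup : charL2 k (4 * k + 2) - (4 * k + 2) ≤ 0 := by
    linarith [charL2_le k (hp.trans hpk.le)]
  obtain ⟨q, hq, h⟩ := intermediate_value_Icc' hpk.le hc ⟨hup, (sub_pos.2 h).le⟩
  have hq' : charL2 k q = q := sub_eq_zero.1 h
  refine ⟨q, lt_of_le_of_ne hq.1 ?_, hq'⟩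
  rintro rfl
  linarith

theorem matching_adj (k : ℕ) (a b : Fin k × Fin 2) :
    (matching k).Adj a b ↔ a.1 = b.1 ∧ a.2 ≠ b.2 := by
  simp only [matching, SimpleGraph.fromRel_adj, ne_eq, Prod.ext_iff]
  tauto

theorem cone_adj_none_some {α : Type*} (H : SimpleGraph α) (x : α) :
    (cone H).Adj none (some x) := by
  simp [cone]

theorem cone_adj_some_some {α : Type*} (H : SimpleGraph α) (x y : α) :
    (cone H).Adj (some x) (some y) ↔ H.Adj x y := by
  simpa [cone, H.adj_comm y x] using fun h : H.Adj x y => h.ne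

theorem dUnion_adj_inl_inl {α β : Type*} (G : SimpleGraph α) (H : SimpleGraph β) (x y : α) :
    (dUnion G H).Adj (Sum.inl x) (Sum.inl y) ↔ G.Adj x y := by
  simpa [dUnion, G.adj_comm y x] using fun h : G.Adj x y => h.ne

theorem dUnion_adj_inr_inr {α β : Type*} (G : SimpleGraph α) (H : SimpleGraph β) (x y : β) :
    (dUnion G H).Adj (Sum.inr x) (Sum.inr y) ↔ H.Adj x y := by
  simpa [dUnion, H.adj_comm y x] using fun h : H.Adj x y => h.ne

theorem dUnion_not_adj_inl_inr {α β : Type*} (G : SimpleGraph α) (H : SimpleGraph β)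
    (x : α) (y : β) : ¬ (dUnion G H).Adj (Sum.inl x) (Sum.inr y) := by
  simp [dUnion]

theorem L1_adj_inl_inl (k : ℕ) (x y : Option ((Fin (k - 1) × Fin 2) ⊕ Fin 3)) :
    (L1 k).Adj (Sum.inl x) (Sum.inl y) ↔
      (cone (dUnion (matching (k - 1)) (⊥ : SimpleGraph (Fin 3)))).Adj x y := by
  generalize hG : cone (dUnion (matching (k - 1)) (⊥ : SimpleGraph (Fin 3))) = G
  simpa [L1, hG, G.adj_comm y x] using fun h : G.Adj x y => h.ne

theorem L1_adj_inl_inr (k : ℕ) (x : Option ((Fin (k - 1) × Fin 2) ⊕ Fin 3)) (j : Fin 1) :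
    (L1 k).Adj (Sum.inl x) (Sum.inr j) ↔ ∃ i : Fin 3, i ≠ 0 ∧ x = some (Sum.inr i) := by
  simp [L1, Subsingleton.elim j 0]

theorem L2_adj_inl_inl (k : ℕ) (x y : Option (Fin k × Fin 2)) :
    (L2 k).Adj (Sum.inl x) (Sum.inl y) ↔ (cone (matching k)).Adj x y := by
  generalize hG : cone (matching k) = G
  simpa [L2, hG, G.adj_comm y x] using fun h : G.Adj x y => h.ne

theorem L2_adj_inl_inr (k : ℕ) (x : Option (Fin k × Fin 2)) (j : Fin 2) :
    (L2 k).Adj (Sum.inl x) (Sum.inr j) ↔ x = none ∧ j = 0 := by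
  simp [L2]

theorem L2_adj_inr_inr (k : ℕ) (i j : Fin 2) :
    (L2 k).Adj (Sum.inr i) (Sum.inr j) ↔ i ≠ j := by
  simp only [L2, SimpleGraph.fromRel_adj]
  fin_cases i <;> fin_cases j <;> simp

theorem le_qIndex_L2 {k : ℕ} {q : ℝ} (hq : 4 < q) (h : charL2 k q = q) : q ≤ qIndex (L2 k) := by
  classical
  have h3 : q - 3 ≠ 0 := by linarith
  unfold charL2 at h
  obtain ⟨D, hD⟩ : ∃ D, D = (q - 2) * (q - 1) - 1 := ⟨_, rfl⟩
  have hu : D ≠ 0 := by nlinarith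
  rw [← hD] at h
  have hn := cone_adj_none_some (matching k)
  have hn' := fun x => ((cone (matching k)).adj_comm (some x) none).2 (hn x)
  have hri : ∀ i x, (L2 k).Adj (Sum.inr i) (Sum.inl x) ↔ x = none ∧ i = 0 := fun i x => by
    rw [SimpleGraph.adj_comm, L2_adj_inl_inr]
  refine le_qIndex (L2 k)
    (x := Sum.elim (fun o => o.elim 1 fun _ => 1 / (q - 3)) ![(q - 1) / D, 1 / D]) ?_ ?_
  · intro h0
    simpa using congrFun h0 (Sum.inl none)
  · funext i
    rw [signlessLap_mulVec]
    rcases i with (_ | ⟨a, b⟩) | i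
    · simp [L2_adj_inl_inl, L2_adj_inl_inr, hn]
      refine Eq.trans ?_ h
      ring
    · fin_cases b <;> simp [L2_adj_inl_inl, L2_adj_inl_inr, hn', cone_adj_some_some, matching_adj,
        Fintype.sum_prod_type] <;> field_simp <;> ring
    · fin_cases i <;> simp [L2_adj_inr_inr, hri] <;> field_simp
      · rw [hD]
        ring
      · ring

theorem qIndex_L1_le {k : ℕ} (hk : 1 ≤ k) {q : ℝ} (hq : 4 < q) (h : charL1 k q = q) :
    qIndex (L1 k) ≤ q := by
  classical
  have h3 : 0 < q - 3 := by linarith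
  have h1 : 0 < q - 1 := by linarith
  have h2 : 0 < q - 2 := by linarith
  unfold charL1 at h
  obtain ⟨D, hD⟩ : ∃ D, D = (q - 2) ^ 2 - 2 := ⟨_, rfl⟩
  have hz : 0 < D := by nlinarith
  rw [← hD] at h
  have hn := cone_adj_none_some (dUnion (matching (k - 1)) (⊥ : SimpleGraph (Fin 3)))
  have hn' := fun x => ((cone (dUnion (matching (k - 1)) (⊥ : SimpleGraph (Fin 3)))).adj_comm
    (some x) none).2 (hn x)
  have hri : ∀ i x, (L1 k).Adj (Sum.inr i) (Sum.inl x) ↔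
      ∃ i : Fin 3, i ≠ 0 ∧ x = some (Sum.inr i) := fun i x => by
    rw [SimpleGraph.adj_comm, L1_adj_inl_inr]
  have hd := dUnion_not_adj_inl_inr (matching (k - 1)) (⊥ : SimpleGraph (Fin 3))
  have hd' := fun x y => mt (SimpleGraph.adj_comm _ _ _).1 (hd x y)
  refine qIndex_le (L1 k) (by linarith)
    (x := Sum.elim (fun o => o.elim 1 (Sum.elim (fun _ => 1 / (q - 3))
      ![1 / (q - 1), (q - 2) / D, (q - 2) / D])) (fun _ => 2 / D)) ?_ ?_
  · rintro ((_ | ⟨a, b⟩ | i) | i)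
    · simp
    · simpa using h3
    · fin_cases i
      · simpa using h1
      · simpa using div_pos h2 hz
      · simpa using div_pos h2 hz
    · simpa using hz
  · intro i
    refine le_of_eq ?_
    rw [signlessLap_mulVec]
    rcases i with (_ | ⟨a, b⟩ | i) | i
    · simp [L1_adj_inl_inl, L1_adj_inl_inr, hn, Fin.sum_univ_three]
      refine Eq.trans ?_ h
      rw [Nat.cast_sub hk]
      push_cast
      ring
    · fin_cases b <;> simp [L1_adj_inl_inl, L1_adj_inl_inr, hn', hd, cone_adj_some_some,
        dUnion_adj_inl_inl, matching_adj, Fintype.sum_prod_type] <;> field_simp <;> ring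
    · fin_cases i <;> simp [L1_adj_inl_inl, L1_adj_inl_inr, hn', hd', cone_adj_some_some,
        dUnion_adj_inr_inr] <;> field_simp
      · ring
      · rw [hD]
        ring
      · rw [hD]
        ring
    · obtain rfl := Subsingleton.elim 0 i
      simp [hri, Fin.sum_univ_three]
      field_simp
      ring

theorem stmt12 (k : ℕ) (hk : 2 ≤ k) :
    qIndex (L2 k) > qIndex (L1 k) := by
  obtain ⟨p, hp, hpk, hp1⟩ := exists_charL1_eq hk
  obtain ⟨q, hpq, hq⟩ := exists_charL2_eq k hp.le hpk
    (by simpa [hp1] using charL1_lt_charL2 k hp.le)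
  calc qIndex (L1 k) ≤ p := qIndex_L1_le (by omega) hp hp1
    _ < q := hpq
    _ ≤ qIndex (L2 k) := le_qIndex_L2 (hp.trans hpq) hq

end QPaper
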